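/- Let X be a finite nonempty set, let f : X → A be any function whose image has at most m elements (m ≥ 1), and let r be a positive integer. Then the number of pairs (x, L) ∈ X × X^r such that f(x) ≠ f(L_j) for every coordinate L_j of L is at most ((1 − 1/r)^r + m/r)·|X|^{r+1}. -/

import Mathlib

open scoped Classical

/-- Let `X` be a finite nonempty set, `f : X → A` a function whose image
has at most `m` elements (`m ≥ 1`), and `r` a positive integer. Then the number of pairs
`(x, L) ∈ X × X^r` such that `f x ≠ f (L j)` for every coordinate `L j` of `L` is at most
`((1 - 1/r)^r + m/r)·|X|^{r+1}`. -/
theorem statement6 {α A : Type} (X : Finset α) (hX : X.Nonempty)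
    (f : α → A) (m : ℕ) (hm : 1 ≤ m) (hf : (X.image f).card ≤ m)
    (r : ℕ) (hr : 0 < r) :
    ((((X ×ˢ Fintype.piFinset fun _ : Fin r => X).filter
          fun p => ∀ j : Fin r, f p.1 ≠ f (p.2 j)).card : ℝ)) ≤
      ((1 - 1 / (r : ℝ)) ^ r + (m : ℝ) / (r : ℝ)) * (X.card : ℝ) ^ (r + 1) := by
  have hr' : (0 : ℝ) < r := by exact_mod_cast hr
  have hr1 : 1 / (r : ℝ) ≤ 1 := by
    rw [div_le_one hr']
    exact_mod_cast hr
  have h1 : ((X ×ˢ Fintype.piFinset fun _ : Fin r => X).filter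
          fun p => ∀ j : Fin r, f p.1 ≠ f (p.2 j)).card
      = ∑ x ∈ X, (X.filter fun y => ¬ f y = f x).card ^ r := by
    rw [Finset.card_filter, Finset.sum_product]
    refine Finset.sum_congr rfl fun x _ => ?_
    rw [← Finset.card_filter]
    have : (Fintype.piFinset fun _ : Fin r => X).filter (fun L => ∀ j : Fin r, f x ≠ f (L j))
        = Fintype.piFinset fun _ : Fin r => X.filter fun y => ¬ f y = f x := by
      ext L
      simp only [Finset.mem_filter, Fintype.mem_piFinset, ne_eq, forall_and, eq_comm]
    rw [this, Fintype.card_piFinset]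
    simp
  have h2 : ∀ a : A, ((X.filter fun y => f y = a).card : ℝ)
      * ((X.filter fun y => ¬ f y = a).card : ℝ) ^ r ≤
      (1 - 1 / (r : ℝ)) ^ r * (X.card : ℝ) ^ r * ((X.filter fun y => f y = a).card : ℝ)
        + (X.card : ℝ) ^ (r + 1) / r := by
    intro a
    have hs : ((X.filter fun y => f y = a).card : ℝ) + ((X.filter fun y => ¬ f y = a).card : ℝ)
        = X.card := by
      exact_mod_cast Finset.card_filter_add_card_filter_not (s := X) (fun y => f y = a)
    generalize ((X.filter fun y => f y = a).card) = c at *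
    generalize ((X.filter fun y => ¬ f y = a).card) = d at *
    generalize X.card = n at *
    have hc : (0 : ℝ) ≤ c := Nat.cast_nonneg c
    have hd : (0 : ℝ) ≤ d := Nat.cast_nonneg d
    have hn : (0 : ℝ) ≤ n := Nat.cast_nonneg n
    have h0 : 0 ≤ 1 - 1 / (r : ℝ) := by linarith
    rcases le_total (c : ℝ) (n / r) with h | h
    · have : (c : ℝ) * (d : ℝ) ^ r ≤ n / r * (n : ℝ) ^ r := by
        have hdn : (d : ℝ) ≤ n := by linarith
        exact mul_le_mul h (pow_le_pow_left₀ hd hdn r) (by positivity) (by positivity)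
      have e : (n : ℝ) ^ (r + 1) / r = n / r * (n : ℝ) ^ r := by ring
      rw [e]
      have : 0 ≤ (1 - 1 / (r : ℝ)) ^ r * (n : ℝ) ^ r * (c : ℝ) := by positivity
      linarith
    · have hd' : (d : ℝ) ≤ (1 - 1 / (r : ℝ)) * n := by
        have : (1 - 1 / (r : ℝ)) * n = n - n / r := by ring
        linarith
      have h3 : (d : ℝ) ^ r ≤ (1 - 1 / (r : ℝ)) ^ r * (n : ℝ) ^ r := by
        rw [← mul_pow]
        gcongr
      have h4 := mul_le_mul_of_nonneg_left h3 hc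
      have : 0 ≤ (n : ℝ) ^ (r + 1) / r := by positivity
      linarith
  have h5 : ∑ a ∈ X.image f, ((X.filter fun y => f y = a).card : ℝ) = X.card := by
    exact_mod_cast (Finset.card_eq_sum_card_image f X).symm
  rw [h1]
  push_cast
  rw [Finset.sum_comp (fun a => ((X.filter fun y => ¬ f y = a).card : ℝ) ^ r) f]
  simp only [nsmul_eq_mul]
  refine (Finset.sum_le_sum fun a _ => h2 a).trans ?_
  rw [Finset.sum_add_distrib, ← Finset.mul_sum, h5, Finset.sum_const, nsmul_eq_mul]
  have h6 : ((X.image f).card : ℝ) ≤ m := by exact_mod_cast hf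
  have h7 : 0 ≤ (X.card : ℝ) ^ (r + 1) / r := by positivity
  have h8 := mul_le_mul_of_nonneg_right h6 h7
  calc _ ≤ (1 - 1 / (r : ℝ)) ^ r * (X.card : ℝ) ^ r * X.card
        + m * ((X.card : ℝ) ^ (r + 1) / r) := by linarith
    _ = _ := by ring
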